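/- arXiv:2004.07221 — 2 statements merged into one kernel-verified Lean document; each statement's English description precedes it below -/
import Mathlib

section
/- For every Prior-LTL ontology O and every Prior-LTL formula κ, the ontology-mediated query (O, κ) is FO(<)-rewritable: there is a constant-free FO(<)-formula q(t) with one free variable t such that, for every data instance A, {ℓ ∈ tem(A) : ℓ ∈ κ^M for every model M of (O, A)} = {ℓ ∈ tem(A) : S_A ⊨ q(ℓ)}. -/
namespace LTLOMQ

/-! ## Temporal concepts (LTL formulas) and their semantics over (ℤ,<) -/

/-- Temporal concepts: arbitrary LTL formulas over atomic concepts indexed by `ℕ`. -/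
inductive TC : Type where
  | top : TC
  | atom : ℕ → TC
  | neg : TC → TC
  | and : TC → TC → TC
  | or : TC → TC → TC
  | nextF : TC → TC
  | diamF : TC → TC
  | boxF : TC → TC
  | untl : TC → TC → TC
  | nextP : TC → TC
  | diamP : TC → TC
  | boxP : TC → TC
  | since : TC → TC → TC

/-- A temporal interpretation assigns to each atomic concept a subset of ℤ. -/
abbrev Itp : Type := ℕ → Set ℤ

/-- The extension of a temporal concept in an interpretation
(strict semantics over `(ℤ,<)`). -/
def TC.sem (M : Itp) : TC → Set ℤ
  | .top => Set.univ
  | .atom a => M a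
  | .neg C => (TC.sem M C)ᶜ
  | .and C D => TC.sem M C ∩ TC.sem M D
  | .or C D => TC.sem M C ∪ TC.sem M D
  | .nextF C => {n | n + 1 ∈ TC.sem M C}
  | .diamF C => {n | ∃ k, n < k ∧ k ∈ TC.sem M C}
  | .boxF C => {n | ∀ k, n < k → k ∈ TC.sem M C}
  | .untl C D => {n | ∃ k, n < k ∧ k ∈ TC.sem M D ∧ ∀ m, n < m → m < k → m ∈ TC.sem M C}
  | .nextP C => {n | n - 1 ∈ TC.sem M C}
  | .diamP C => {n | ∃ k, k < n ∧ k ∈ TC.sem M C}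
  | .boxP C => {n | ∀ k, k < n → k ∈ TC.sem M C}
  | .since C D => {n | ∃ k, k < n ∧ k ∈ TC.sem M D ∧ ∀ m, k < m → m < n → m ∈ TC.sem M C}

/-- Basic temporal concepts: built from atomic concepts using ○F, ○P, □F, □P. -/
inductive TC.IsBasic : TC → Prop
  | atom (a : ℕ) : TC.IsBasic (.atom a)
  | nextF {C : TC} : TC.IsBasic C → TC.IsBasic (.nextF C)
  | nextP {C : TC} : TC.IsBasic C → TC.IsBasic (.nextP C)
  | boxF {C : TC} : TC.IsBasic C → TC.IsBasic (.boxF C)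
  | boxP {C : TC} : TC.IsBasic C → TC.IsBasic (.boxP C)

/-- Basic temporal concepts using □F and □P only. -/
inductive TC.IsBasicBox : TC → Prop
  | atom (a : ℕ) : TC.IsBasicBox (.atom a)
  | boxF {C : TC} : TC.IsBasicBox C → TC.IsBasicBox (.boxF C)
  | boxP {C : TC} : TC.IsBasicBox C → TC.IsBasicBox (.boxP C)

/-- Basic temporal concepts using ○F and ○P only. -/
inductive TC.IsBasicNext : TC → Prop
  | atom (a : ℕ) : TC.IsBasicNext (.atom a)
  | nextF {C : TC} : TC.IsBasicNext C → TC.IsBasicNext (.nextF C)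
  | nextP {C : TC} : TC.IsBasicNext C → TC.IsBasicNext (.nextP C)

/-- Positive temporal concepts: no occurrences of ¬. -/
inductive TC.IsPositive : TC → Prop
  | top : TC.IsPositive .top
  | atom (a : ℕ) : TC.IsPositive (.atom a)
  | and {C D : TC} : TC.IsPositive C → TC.IsPositive D → TC.IsPositive (.and C D)
  | or {C D : TC} : TC.IsPositive C → TC.IsPositive D → TC.IsPositive (.or C D)
  | nextF {C : TC} : TC.IsPositive C → TC.IsPositive (.nextF C)
  | diamF {C : TC} : TC.IsPositive C → TC.IsPositive (.diamF C)
  | boxF {C : TC} : TC.IsPositive C → TC.IsPositive (.boxF C)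
  | untl {C D : TC} : TC.IsPositive C → TC.IsPositive D → TC.IsPositive (.untl C D)
  | nextP {C : TC} : TC.IsPositive C → TC.IsPositive (.nextP C)
  | diamP {C : TC} : TC.IsPositive C → TC.IsPositive (.diamP C)
  | boxP {C : TC} : TC.IsPositive C → TC.IsPositive (.boxP C)
  | since {C D : TC} : TC.IsPositive C → TC.IsPositive D → TC.IsPositive (.since C D)

/-- Prior-LTL formulas: Boolean connectives and □P, ◇P, □F, ◇F only. -/
inductive TC.IsPrior : TC → Prop
  | atom (a : ℕ) : TC.IsPrior (.atom a)
  | neg {C : TC} : TC.IsPrior C → TC.IsPrior (.neg C)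
  | and {C D : TC} : TC.IsPrior C → TC.IsPrior D → TC.IsPrior (.and C D)
  | or {C D : TC} : TC.IsPrior C → TC.IsPrior D → TC.IsPrior (.or C D)
  | boxF {C : TC} : TC.IsPrior C → TC.IsPrior (.boxF C)
  | boxP {C : TC} : TC.IsPrior C → TC.IsPrior (.boxP C)
  | diamF {C : TC} : TC.IsPrior C → TC.IsPrior (.diamF C)
  | diamP {C : TC} : TC.IsPrior C → TC.IsPrior (.diamP C)

/-- Number of occurrences of temporal operators in a temporal concept. -/
def TC.tempOps : TC → ℕ
  | .top => 0
  | .atom _ => 0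
  | .neg C => TC.tempOps C
  | .and C D => TC.tempOps C + TC.tempOps D
  | .or C D => TC.tempOps C + TC.tempOps D
  | .nextF C => TC.tempOps C + 1
  | .diamF C => TC.tempOps C + 1
  | .boxF C => TC.tempOps C + 1
  | .untl C D => TC.tempOps C + TC.tempOps D + 1
  | .nextP C => TC.tempOps C + 1
  | .diamP C => TC.tempOps C + 1
  | .boxP C => TC.tempOps C + 1
  | .since C D => TC.tempOps C + TC.tempOps D + 1

/-- Number of occurrences of symbols in a temporal concept. -/
def TC.size : TC → ℕ
  | .top => 1
  | .atom _ => 1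
  | .neg C => TC.size C + 1
  | .and C D => TC.size C + TC.size D + 1
  | .or C D => TC.size C + TC.size D + 1
  | .nextF C => TC.size C + 1
  | .diamF C => TC.size C + 1
  | .boxF C => TC.size C + 1
  | .untl C D => TC.size C + TC.size D + 1
  | .nextP C => TC.size C + 1
  | .diamP C => TC.size C + 1
  | .boxP C => TC.size C + 1
  | .since C D => TC.size C + TC.size D + 1

/-- The set of subconcepts of a temporal concept. -/
def TC.subs : TC → Set TC
  | .top => {.top}
  | .atom a => {.atom a}
  | .neg C => insert (.neg C) (TC.subs C)
  | .and C D => insert (.and C D) (TC.subs C ∪ TC.subs D)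
  | .or C D => insert (.or C D) (TC.subs C ∪ TC.subs D)
  | .nextF C => insert (.nextF C) (TC.subs C)
  | .diamF C => insert (.diamF C) (TC.subs C)
  | .boxF C => insert (.boxF C) (TC.subs C)
  | .untl C D => insert (.untl C D) (TC.subs C ∪ TC.subs D)
  | .nextP C => insert (.nextP C) (TC.subs C)
  | .diamP C => insert (.diamP C) (TC.subs C)
  | .boxP C => insert (.boxP C) (TC.subs C)
  | .since C D => insert (.since C D) (TC.subs C ∪ TC.subs D)

/-- The set of atomic concepts occurring in a temporal concept. -/
def TC.atoms : TC → Set ℕ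
  | .top => ∅
  | .atom a => {a}
  | .neg C => TC.atoms C
  | .and C D => TC.atoms C ∪ TC.atoms D
  | .or C D => TC.atoms C ∪ TC.atoms D
  | .nextF C => TC.atoms C
  | .diamF C => TC.atoms C
  | .boxF C => TC.atoms C
  | .untl C D => TC.atoms C ∪ TC.atoms D
  | .nextP C => TC.atoms C
  | .diamP C => TC.atoms C
  | .boxP C => TC.atoms C
  | .since C D => TC.atoms C ∪ TC.atoms D

/-! ## Clauses, ontologies, data instances -/

/-- A clause `C₁ ∧ … ∧ C_k → C_{k+1} ∨ … ∨ C_{k+m}`. -/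
structure Clause : Type where
  prem : List TC
  concl : List TC

/-- A clause is true in `M` if the intersection of the extensions of the premises
is contained in the union of the extensions of the conclusions. -/
def Clause.holds (M : Itp) (cl : Clause) : Prop :=
  ∀ n : ℤ, (∀ C ∈ cl.prem, n ∈ TC.sem M C) → ∃ C ∈ cl.concl, n ∈ TC.sem M C

/-- An ontology is a finite set (list) of clauses. -/
abbrev Ontology : Type := List Clause

def Clause.AllBasic (cl : Clause) : Prop :=
  (∀ C ∈ cl.prem, C.IsBasic) ∧ (∀ C ∈ cl.concl, C.IsBasic)

def Clause.AllBasicBox (cl : Clause) : Prop :=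
  (∀ C ∈ cl.prem, C.IsBasicBox) ∧ (∀ C ∈ cl.concl, C.IsBasicBox)

def Clause.AllBasicNext (cl : Clause) : Prop :=
  (∀ C ∈ cl.prem, C.IsBasicNext) ∧ (∀ C ∈ cl.concl, C.IsBasicNext)

/-- Horn: at most one disjunct in the conclusion. -/
def Clause.Horn (cl : Clause) : Prop := cl.concl.length ≤ 1

/-- Krom (binary): at most two concepts altogether. -/
def Clause.Krom (cl : Clause) : Prop := cl.prem.length + cl.concl.length ≤ 2

/-- LTL_bool^□○ ontologies. -/
def Ontology.BoolBoxNext (O : Ontology) : Prop := ∀ cl ∈ O, cl.AllBasic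
/-- LTL_bool^□ ontologies. -/
def Ontology.BoolBox (O : Ontology) : Prop := ∀ cl ∈ O, cl.AllBasicBox
/-- LTL_krom^○ ontologies. -/
def Ontology.KromNext (O : Ontology) : Prop := ∀ cl ∈ O, cl.AllBasicNext ∧ cl.Krom
/-- LTL_krom^□○ ontologies. -/
def Ontology.KromBoxNext (O : Ontology) : Prop := ∀ cl ∈ O, cl.AllBasic ∧ cl.Krom
/-- LTL_horn^□○ ontologies. -/
def Ontology.HornBoxNext (O : Ontology) : Prop := ∀ cl ∈ O, cl.AllBasic ∧ cl.Horn
/-- LTL_horn^□ ontologies. -/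
def Ontology.HornBox (O : Ontology) : Prop := ∀ cl ∈ O, cl.AllBasicBox ∧ cl.Horn
/-- LTL_core^□○ ontologies. -/
def Ontology.CoreBoxNext (O : Ontology) : Prop := ∀ cl ∈ O, cl.AllBasic ∧ cl.Horn ∧ cl.Krom

/-- Number of occurrences of symbols in a clause. -/
def Clause.size (cl : Clause) : ℕ :=
  (cl.prem.map TC.size).sum + (cl.concl.map TC.size).sum + 1

/-- Number of occurrences of symbols in an ontology. -/
def Ontology.size (O : Ontology) : ℕ := (O.map Clause.size).sum

/-- The atomic concept `a` occurs in the ontology `O`. -/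
def Ontology.occurs (O : Ontology) (a : ℕ) : Prop :=
  ∃ cl ∈ O, (∃ C ∈ cl.prem, a ∈ C.atoms) ∨ (∃ C ∈ cl.concl, a ∈ C.atoms)

/-- The set of subconcepts of (concepts occurring in) an ontology. -/
def Ontology.subs (O : Ontology) : Set TC :=
  {C | ∃ cl ∈ O, ∃ D : TC, (D ∈ cl.prem ∨ D ∈ cl.concl) ∧ C ∈ D.subs}

/-- A flat concept: an atomic concept, or a single ○F or ○P applied to an atomic concept. -/
def TC.IsFlat : TC → Prop
  | .atom _ => True
  | .nextF (.atom _) => True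
  | .nextP (.atom _) => True
  | _ => False

/-- An ontology without nested temporal operators. -/
def Ontology.Flat (O : Ontology) : Prop :=
  ∀ cl ∈ O, (∀ C ∈ cl.prem, C.IsFlat) ∧ (∀ C ∈ cl.concl, C.IsFlat)

/-- A data instance: a finite nonempty set of timestamped atoms, normalized so that
the minimal timestamp is 0 and the maximal one is ≥ 1. -/
structure DataInstance : Type where
  atoms : Finset (ℕ × ℤ)
  nonneg : ∀ p ∈ atoms, 0 ≤ p.2
  has_zero : ∃ p ∈ atoms, p.2 = 0
  has_one : ∃ p ∈ atoms, 1 ≤ p.2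

theorem DataInstance.ts_nonempty (A : DataInstance) :
    (A.atoms.image Prod.snd).Nonempty := by
  obtain ⟨p, hp, -⟩ := A.has_zero
  exact ⟨p.2, Finset.mem_image_of_mem _ hp⟩

/-- min A: the minimal timestamp occurring in the data instance (equal to 0). -/
def DataInstance.minT (A : DataInstance) : ℤ :=
  (A.atoms.image Prod.snd).min' A.ts_nonempty

/-- max A: the maximal timestamp occurring in the data instance. -/
def DataInstance.maxT (A : DataInstance) : ℤ :=
  (A.atoms.image Prod.snd).max' A.ts_nonempty

/-- The active temporal domain tem(A). -/
def DataInstance.tem (A : DataInstance) : Set ℤ := Set.Icc A.minT A.maxT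

/-- The interpretation of atomic concepts in the first-order structure S_A. -/
def DataInstance.itp (A : DataInstance) : Itp := fun a => {n | (a, n) ∈ A.atoms}

/-- `M` is a model of the knowledge base `(O, A)`. -/
def IsModel (M : Itp) (O : Ontology) (A : DataInstance) : Prop :=
  (∀ cl ∈ O, cl.holds M) ∧ ∀ p ∈ A.atoms, p.2 ∈ M p.1

/-- The ontology `O` is consistent. -/
def Ontology.Consistent (O : Ontology) : Prop := ∃ M : Itp, ∀ cl ∈ O, cl.holds M

/-- The data instance `A` is consistent with `O`. -/
def ConsistentWith (O : Ontology) (A : DataInstance) : Prop := ∃ M : Itp, IsModel M O A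

/-- Certain answers to the OMIQ `(O, κ)` over `A` (within the active domain). -/
def certAns (O : Ontology) (κ : TC) (A : DataInstance) : Set ℤ :=
  {ℓ | ℓ ∈ A.tem ∧ ∀ M : Itp, IsModel M O A → ℓ ∈ TC.sem M κ}

/-- Certain answers to the OMIQ `(O, κ)` over `A` and ℤ. -/
def certAnsZ (O : Ontology) (κ : TC) (A : DataInstance) : Set ℤ :=
  {ℓ | ∀ M : Itp, IsModel M O A → ℓ ∈ TC.sem M κ}

/-! ## First-order, MSO and FO(RPR) formulas over the temporal structures -/

/-- Formulas of the target languages: first-order variables are indexed by `ℕ`,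
as are second-order (set) variables and the recursively defined relation variables
of FO(RPR).  The constructors `qprev j` and `qapp j x` stand for `Q_j(t-1)` (inside
a recursive definition block) and `Q_j(x)`, respectively; `rpr n Θ tv ψ` is the
relational-primitive-recursion construct `[Q₁(t) ≡ Θ₁; …; Q_n(t) ≡ Θ_n] ψ`
with recursion variable `tv`. -/
inductive Fml : Type where
  | falsum : Fml
  | atom : ℕ → ℕ → Fml        -- A(x)
  | lt : ℕ → ℕ → Fml          -- x < y
  | eq : ℕ → ℕ → Fml          -- x = y
  | succ : ℕ → ℕ → Fml        -- x = y + 1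
  | mod : ℕ → ℕ → Fml         -- x ≡ 0 (mod n)
  | svar : ℕ → ℕ → Fml        -- X(x), X a set variable
  | qprev : ℕ → Fml           -- Q_j(t−1)
  | qapp : ℕ → ℕ → Fml        -- Q_j(x)
  | neg : Fml → Fml
  | and : Fml → Fml → Fml
  | or : Fml → Fml → Fml
  | ex : ℕ → Fml → Fml
  | all : ℕ → Fml → Fml
  | exS : ℕ → Fml → Fml       -- second-order ∃
  | allS : ℕ → Fml → Fml      -- second-order ∀
  | rpr : (n : ℕ) → (Fin n → Fml) → ℕ → Fml → Fml

/-- Evaluation of a formula over the structure with (active) domain `D ⊆ ℤ`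
and interpretation `I` of the unary predicates; `env` assigns first-order
variables, `senv` set variables, `prev` the placeholders `Q_j(t-1)` and
`Q` the defined relation variables. First-order quantifiers range over `D`,
second-order quantifiers over subsets of `D`. -/
def Fml.eval (D : Set ℤ) (I : ℕ → Set ℤ) :
    Fml → (ℕ → ℤ) → (ℕ → Set ℤ) → (ℕ → Prop) → (ℕ → ℤ → Prop) → Prop
  | .falsum, _, _, _, _ => False
  | .atom a x, env, _, _, _ => env x ∈ I a
  | .lt x y, env, _, _, _ => env x < env y
  | .eq x y, env, _, _, _ => env x = env y
  | .succ x y, env, _, _, _ => env x = env y + 1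
  | .mod n x, env, _, _, _ => (n : ℤ) ∣ env x
  | .svar X x, env, senv, _, _ => env x ∈ senv X
  | .qprev j, _, _, prev, _ => prev j
  | .qapp j x, env, _, _, Q => Q j (env x)
  | .neg φ, env, senv, prev, Q => ¬ Fml.eval D I φ env senv prev Q
  | .and φ ψ, env, senv, prev, Q =>
      Fml.eval D I φ env senv prev Q ∧ Fml.eval D I ψ env senv prev Q
  | .or φ ψ, env, senv, prev, Q =>
      Fml.eval D I φ env senv prev Q ∨ Fml.eval D I ψ env senv prev Q
  | .ex x φ, env, senv, prev, Q =>
      ∃ d ∈ D, Fml.eval D I φ (Function.update env x d) senv prev Q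
  | .all x φ, env, senv, prev, Q =>
      ∀ d ∈ D, Fml.eval D I φ (Function.update env x d) senv prev Q
  | .exS X φ, env, senv, prev, Q =>
      ∃ S : Set ℤ, S ⊆ D ∧ Fml.eval D I φ env (Function.update senv X S) prev Q
  | .allS X φ, env, senv, prev, Q =>
      ∀ S : Set ℤ, S ⊆ D → Fml.eval D I φ env (Function.update senv X S) prev Q
  | .rpr n Θ tv ψ, env, senv, prev, Q =>
      -- the semantics of each Θ_j, as a function of the first-order environment
      -- and of the truth values of the `Q_j(t−1)` placeholders
      let f : Fin n → (ℕ → ℤ) → (ℕ → Prop) → Prop :=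
        fun j env' prev' => Fml.eval D I (Θ j) env' senv prev' Q
      -- the recursively computed truth values of `Q_j` at time `k` (recursion on k from 0)
      let recQ : ℕ → Fin n → Prop := fun k =>
        Nat.rec (fun j => f j (Function.update env tv 0) (fun _ => False))
          (fun m ih j => f j (Function.update env tv ((m : ℤ) + 1))
            (fun i => ∃ h : i < n, ih ⟨i, h⟩)) k
      Fml.eval D I ψ env senv prev
        (fun j z => ∃ h : j < n, 0 ≤ z ∧ recQ z.toNat ⟨j, h⟩)

/-- Free first-order variables of a formula. -/
def Fml.fvars : Fml → Set ℕ
  | .falsum => ∅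
  | .atom _ x => {x}
  | .lt x y => {x, y}
  | .eq x y => {x, y}
  | .succ x y => {x, y}
  | .mod _ x => {x}
  | .svar _ x => {x}
  | .qprev _ => ∅
  | .qapp _ x => {x}
  | .neg φ => Fml.fvars φ
  | .and φ ψ => Fml.fvars φ ∪ Fml.fvars ψ
  | .or φ ψ => Fml.fvars φ ∪ Fml.fvars ψ
  | .ex x φ => Fml.fvars φ \ {x}
  | .all x φ => Fml.fvars φ \ {x}
  | .exS _ φ => Fml.fvars φ
  | .allS _ φ => Fml.fvars φ
  | .rpr n Θ tv ψ => (⋃ j : Fin n, Fml.fvars (Θ j) \ {tv}) ∪ Fml.fvars ψ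

/-- FO(<)-formulas: first-order logic with the built-in linear order
(and the definable equality predicate); no constants, no arithmetic. -/
def Fml.IsFOlt : Fml → Prop
  | .falsum => True
  | .atom _ _ => True
  | .lt _ _ => True
  | .eq _ _ => True
  | .neg φ => Fml.IsFOlt φ
  | .and φ ψ => Fml.IsFOlt φ ∧ Fml.IsFOlt ψ
  | .or φ ψ => Fml.IsFOlt φ ∧ Fml.IsFOlt ψ
  | .ex _ φ => Fml.IsFOlt φ
  | .all _ φ => Fml.IsFOlt φ
  | _ => False

/-- FO(<,≡)-formulas: FO(<) extended with the predicates `t ≡ 0 (mod n)`, `n > 1`. -/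
def Fml.IsFOltMod : Fml → Prop
  | .falsum => True
  | .atom _ _ => True
  | .lt _ _ => True
  | .eq _ _ => True
  | .mod n _ => 2 ≤ n
  | .neg φ => Fml.IsFOltMod φ
  | .and φ ψ => Fml.IsFOltMod φ ∧ Fml.IsFOltMod ψ
  | .or φ ψ => Fml.IsFOltMod φ ∧ Fml.IsFOltMod ψ
  | .ex _ φ => Fml.IsFOltMod φ
  | .all _ φ => Fml.IsFOltMod φ
  | _ => False

/-- MSO(<)-formulas: FO(<) extended with set variables and second-order quantifiers. -/
def Fml.IsMSO : Fml → Prop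
  | .falsum => True
  | .atom _ _ => True
  | .lt _ _ => True
  | .eq _ _ => True
  | .svar _ _ => True
  | .neg φ => Fml.IsMSO φ
  | .and φ ψ => Fml.IsMSO φ ∧ Fml.IsMSO ψ
  | .or φ ψ => Fml.IsMSO φ ∧ Fml.IsMSO ψ
  | .ex _ φ => Fml.IsMSO φ
  | .all _ φ => Fml.IsMSO φ
  | .exS _ φ => Fml.IsMSO φ
  | .allS _ φ => Fml.IsMSO φ
  | _ => False

/-- FO(RPR)-formulas: FO(<) extended with successor and relational primitive recursion. -/
def Fml.IsRPR : Fml → Prop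
  | .falsum => True
  | .atom _ _ => True
  | .lt _ _ => True
  | .eq _ _ => True
  | .succ _ _ => True
  | .qprev _ => True
  | .qapp _ _ => True
  | .neg φ => Fml.IsRPR φ
  | .and φ ψ => Fml.IsRPR φ ∧ Fml.IsRPR ψ
  | .or φ ψ => Fml.IsRPR φ ∧ Fml.IsRPR ψ
  | .ex _ φ => Fml.IsRPR φ
  | .all _ φ => Fml.IsRPR φ
  | .rpr n Θ _ ψ => (∀ j : Fin n, Fml.IsRPR (Θ j)) ∧ Fml.IsRPR ψ
  | _ => False

/-- MFO(<)-formulas: monadic first-order formulas built from atoms `A(t)`,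
`t < t'`, `t = t'` and `t = t' + 1`. -/
def Fml.IsMFO : Fml → Prop
  | .falsum => True
  | .atom _ _ => True
  | .lt _ _ => True
  | .eq _ _ => True
  | .succ _ _ => True
  | .neg φ => Fml.IsMFO φ
  | .and φ ψ => Fml.IsMFO φ ∧ Fml.IsMFO ψ
  | .or φ ψ => Fml.IsMFO φ ∧ Fml.IsMFO ψ
  | .ex _ φ => Fml.IsMFO φ
  | .all _ φ => Fml.IsMFO φ
  | _ => False

/-- Quasi-positive MFO(<)-formulas: built from atoms `A(t)`, `t < t'`, `t = t'`,
`t = t' + 1` (and ⊥) using ∧, ∨, ∃, ∀ as well as guarded universal quantification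
`∀y (x < y < z → φ)`, `∀y (x < y → φ)`, `∀y (y < z → φ)`
(the guarded implications are encoded via `¬guard ∨ φ`). -/
inductive Fml.IsQP : Fml → Prop
  | falsum : Fml.IsQP .falsum
  | atom (a x : ℕ) : Fml.IsQP (.atom a x)
  | lt (x y : ℕ) : Fml.IsQP (.lt x y)
  | eq (x y : ℕ) : Fml.IsQP (.eq x y)
  | succ (x y : ℕ) : Fml.IsQP (.succ x y)
  | and {φ ψ : Fml} : Fml.IsQP φ → Fml.IsQP ψ → Fml.IsQP (.and φ ψ)
  | or {φ ψ : Fml} : Fml.IsQP φ → Fml.IsQP ψ → Fml.IsQP (.or φ ψ)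
  | ex (x : ℕ) {φ : Fml} : Fml.IsQP φ → Fml.IsQP (.ex x φ)
  | all (x : ℕ) {φ : Fml} : Fml.IsQP φ → Fml.IsQP (.all x φ)
  | allBtw (y x z : ℕ) {φ : Fml} : Fml.IsQP φ →
      Fml.IsQP (.all y (.or (.neg (.and (.lt x y) (.lt y z))) φ))
  | allGt (y x : ℕ) {φ : Fml} : Fml.IsQP φ →
      Fml.IsQP (.all y (.or (.neg (.lt x y)) φ))
  | allLt (y z : ℕ) {φ : Fml} : Fml.IsQP φ →
      Fml.IsQP (.all y (.or (.neg (.lt y z)) φ))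

/-- Evaluation in a structure with domain `D` and unary predicates `I`
(no set variables, placeholders or relation variables supplied). -/
def Fml.evalIn (D : Set ℤ) (I : Itp) (φ : Fml) (env : ℕ → ℤ) : Prop :=
  Fml.eval D I φ env (fun _ => ∅) (fun _ => False) (fun _ _ => False)

/-- An MFO(<)-formula is monotone if it is preserved under adding time points
to the extensions of the atomic concepts. -/
def MonotoneFml (ψ : Fml) : Prop :=
  ∀ M₁ M₂ : Itp, (∀ a : ℕ, M₁ a ⊆ M₂ a) → ∀ env : ℕ → ℤ,
    Fml.evalIn Set.univ M₁ ψ env → Fml.evalIn Set.univ M₂ ψ env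

/-! ## The canonical model of a Horn ontology and a data instance -/

/-- Atoms of the closure: ⊥ or `C(n)` for a (basic) temporal concept `C` and `n ∈ ℤ`. -/
inductive EAtom : Type where
  | bot : EAtom
  | conc : TC → ℤ → EAtom

/-- One (non-recursive) application of the closure rules of the canonical model. -/
def clStep (O : Ontology) (Λ : Set EAtom) : Set EAtom :=
  Λ ∪
  {e | ∃ cl ∈ O, ∃ n : ℤ, (∀ C ∈ cl.prem, EAtom.conc C n ∈ Λ) ∧
        ((∃ C : TC, cl.concl = [C] ∧ e = EAtom.conc C n) ∨
          (cl.concl = [] ∧ e = EAtom.bot))} ∪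
  {e | ∃ C : TC, ∃ n k : ℤ, n < k ∧ EAtom.conc (.boxF C) n ∈ Λ ∧ e = EAtom.conc C k} ∪
  {e | ∃ C : TC, ∃ n : ℤ, (∀ k : ℤ, n < k → EAtom.conc C k ∈ Λ) ∧
        e = EAtom.conc (.boxF C) n} ∪
  {e | ∃ C : TC, ∃ n : ℤ, EAtom.conc (.nextF C) n ∈ Λ ∧ e = EAtom.conc C (n + 1)} ∪
  {e | ∃ C : TC, ∃ n : ℤ, EAtom.conc C (n + 1) ∈ Λ ∧ e = EAtom.conc (.nextF C) n} ∪
  {e | ∃ C : TC, ∃ n k : ℤ, k < n ∧ EAtom.conc (.boxP C) n ∈ Λ ∧ e = EAtom.conc C k} ∪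
  {e | ∃ C : TC, ∃ n : ℤ, (∀ k : ℤ, k < n → EAtom.conc C k ∈ Λ) ∧
        e = EAtom.conc (.boxP C) n} ∪
  {e | ∃ C : TC, ∃ n : ℤ, EAtom.conc (.nextP C) n ∈ Λ ∧ e = EAtom.conc C (n - 1)} ∪
  {e | ∃ C : TC, ∃ n : ℤ, EAtom.conc C (n - 1) ∈ Λ ∧ e = EAtom.conc (.nextP C) n}

/-- Transfinite iteration of the closure rules. -/
noncomputable def clIter (O : Ontology) (Λ : Set EAtom) (o : Ordinal.{0}) : Set EAtom :=
  Ordinal.limitRecOn o Λ (fun _ ih => clStep O ih)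
    (fun o _ ih => ⋃ (o' : Ordinal.{0}), ⋃ (h : o' < o), ih o' h)

/-- The atoms of a data instance, as a set of closure atoms. -/
def dataAtoms (A : DataInstance) : Set EAtom :=
  {e | ∃ p ∈ A.atoms, e = EAtom.conc (.atom p.1) p.2}

open Ordinal in
/-- The canonical model `C_{O,A}`: the closure of `A` under the rules,
iterated up to the first uncountable ordinal ω₁. -/
noncomputable def canon (O : Ontology) (A : DataInstance) : Set EAtom :=
  clIter O (dataAtoms A) (Ordinal.omega 1)

/-- The canonical model regarded as a temporal interpretation. -/
noncomputable def canonItp (O : Ontology) (A : DataInstance) : Itp :=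
  fun a => {n | EAtom.conc (.atom a) n ∈ canon O A}

/-- The type `τ_{O,A}(n)`: the set of subconcepts of `O` that hold at `n`
in the canonical model. -/
noncomputable def tau (O : Ontology) (A : DataInstance) (n : ℤ) : Set TC :=
  {C ∈ O.subs | n ∈ TC.sem (canonItp O A) C}

/-! ## Literals and the reachability relation ⇝ for Krom ontologies -/

/-- A simple literal: an atomic concept with a polarity. -/
abbrev Lit : Type := ℕ × Bool

/-- The temporal concept corresponding to a literal. -/
def Lit.toTC (L : Lit) : TC := if L.2 then .atom L.1 else .neg (.atom L.1)

def TC.iterF : ℕ → TC → TC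
  | 0, C => C
  | k + 1, C => .nextF (TC.iterF k C)

def TC.iterP : ℕ → TC → TC
  | 0, C => C
  | k + 1, C => .nextP (TC.iterP k C)

/-- `○^k C`: `k` occurrences of ○F if `k > 0`, of ○P if `k < 0`. -/
def TC.shift (k : ℤ) (C : TC) : TC :=
  if 0 ≤ k then TC.iterF k.toNat C else TC.iterP (-k).toNat C

/-- `(L₁,n₁) ⇝ (L₂,n₂)`: in every model of `O`,
`(○^{n₁} L₁)^M ⊆ (○^{n₂} L₂)^M`. -/
def leadsTo (O : Ontology) (L₁ : Lit) (n₁ : ℤ) (L₂ : Lit) (n₂ : ℤ) : Prop :=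
  ∀ M : Itp, (∀ cl ∈ O, cl.holds M) →
    TC.sem M (TC.shift n₁ L₁.toTC) ⊆ TC.sem M (TC.shift n₂ L₂.toTC)


/-! ## Thresholds in `ℤ ∪ {-∞, +∞}` -/

/-- A threshold: an integer, `-∞` or `+∞`. -/
inductive Threshold : Type where
  | neg : Threshold
  | fin : ℤ → Threshold
  | pos : Threshold

/-- The comparison of an integer with a threshold. -/
def Threshold.cmp (n : ℤ) : Threshold → Ordering
  | .neg => .gt
  | .fin h => compare n h
  | .pos => .lt

/-- Translation of a threshold by an integer. -/
def Threshold.shift (m : ℤ) : Threshold → Threshold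
  | .neg => .neg
  | .fin h => .fin (h + m)
  | .pos => .pos

theorem Threshold.cmp_shift (n m : ℤ) (h : Threshold) : (h.shift m).cmp n = h.cmp (n - m) := by
  cases h with
  | neg => rfl
  | pos => rfl
  | fin h =>
    simp only [Threshold.shift, Threshold.cmp]
    rcases lt_trichotomy n (h + m) with H | H | H
    · rw [compare_lt_iff_lt.2 H, compare_lt_iff_lt.2 (by omega)]
    · rw [compare_eq_iff_eq.2 H, compare_eq_iff_eq.2 (by omega)]
    · rw [compare_gt_iff_gt.2 H, compare_gt_iff_gt.2 (by omega)]

theorem Threshold.cmp_lt_of_lt {n m : ℤ} {h : Threshold} (hnm : n < m) (hm : h.cmp m ≠ .gt) :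
    h.cmp n = .lt := by
  cases h with
  | neg => exact absurd rfl hm
  | pos => rfl
  | fin h =>
    simp only [Threshold.cmp, ne_eq, compare_gt_iff_gt, compare_lt_iff_lt] at *
    omega

theorem Threshold.cmp_gt_of_lt {n m : ℤ} {h : Threshold} (hnm : n < m) (hn : h.cmp n ≠ .lt) :
    h.cmp m = .gt := by
  cases h with
  | neg => rfl
  | pos => exact absurd rfl hn
  | fin h =>
    simp only [Threshold.cmp, ne_eq, compare_gt_iff_gt, compare_lt_iff_lt] at *
    omega

/-- The condition imposed at a single point by a threshold, which stands for the last
(`d = true`) or the first (`d = false`) point where a property holds: here `o` compares the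
point with the threshold and `b` says whether the point has the property. -/
def PointFits (d : Bool) (o : Ordering) (b : Prop) : Prop :=
  (o = .eq → b) ∧ (o = (if d then .gt else .lt) → ¬ b)

/-- `h` is the last (`d = true`) or first (`d = false`) point of `X`. -/
def Fits (d : Bool) (X : Set ℤ) (h : Threshold) : Prop :=
  (∀ n, PointFits d (h.cmp n) (n ∈ X)) ∧
    (d = true → h = .pos → ∀ n, ∃ k, n < k ∧ k ∈ X) ∧
    (d = false → h = .neg → ∀ n, ∃ k, k < n ∧ k ∈ X)

theorem Fits.cmp_eq_lt_iff {X : Set ℤ} {h : Threshold} (H : Fits true X h) (n : ℤ) :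
    h.cmp n = .lt ↔ ∃ k, n < k ∧ k ∈ X := by
  obtain ⟨hp, hpos, -⟩ := H
  constructor
  · intro hn
    cases h with
    | neg => cases hn
    | pos => exact hpos rfl rfl n
    | fin h => exact ⟨h, compare_lt_iff_lt.1 hn, (hp h).1 (compare_eq_iff_eq.2 rfl)⟩
  · rintro ⟨k, hnk, hk⟩
    exact Threshold.cmp_lt_of_lt hnk fun hgt => (hp k).2 hgt hk

theorem Fits.cmp_eq_gt_iff {X : Set ℤ} {h : Threshold} (H : Fits false X h) (n : ℤ) :
    h.cmp n = .gt ↔ ∃ k, k < n ∧ k ∈ X := by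
  obtain ⟨hp, -, hneg⟩ := H
  constructor
  · intro hn
    cases h with
    | pos => cases hn
    | neg => exact hneg rfl rfl n
    | fin h => exact ⟨h, compare_gt_iff_gt.1 hn, (hp h).1 (compare_eq_iff_eq.2 rfl)⟩
  · rintro ⟨k, hnk, hk⟩
    exact Threshold.cmp_gt_of_lt hnk fun hlt => (hp k).2 hlt hk

theorem exists_fits (d : Bool) (X : Set ℤ) : ∃ h, Fits d X h := by
  rcases X.eq_empty_or_nonempty with rfl | hX
  · cases d
    · exact ⟨.pos, by simp [Fits, PointFits, Threshold.cmp]⟩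
    · exact ⟨.neg, by simp [Fits, PointFits, Threshold.cmp]⟩
  cases d
  · by_cases hb : ∃ b, ∀ z, z ∈ X → b ≤ z
    · obtain ⟨m, hm, hle⟩ := Int.exists_least_of_bdd hb hX
      refine ⟨.fin m, fun n => ⟨fun h => ?_, fun h hn => ?_⟩, by simp, by simp⟩
      · rwa [compare_eq_iff_eq.1 h]
      · have := compare_lt_iff_lt.1 h
        have := hle n hn
        omega
    · push Not at hb
      refine ⟨.neg, fun n => by simp [PointFits, Threshold.cmp], by simp, fun _ _ n => ?_⟩
      obtain ⟨k, hk, hlt⟩ := hb n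
      exact ⟨k, hlt, hk⟩
  · by_cases hb : ∃ b, ∀ z, z ∈ X → z ≤ b
    · obtain ⟨m, hm, hle⟩ := Int.exists_greatest_of_bdd hb hX
      refine ⟨.fin m, fun n => ⟨fun h => ?_, fun h hn => ?_⟩, by simp, by simp⟩
      · rwa [compare_eq_iff_eq.1 h]
      · have := compare_gt_iff_gt.1 h
        have := hle n hn
        omega
    · push Not at hb
      refine ⟨.pos, fun n => by simp [PointFits, Threshold.cmp], fun _ _ n => ?_, by simp⟩
      obtain ⟨k, hk, hlt⟩ := hb n
      exact ⟨k, hlt, hk⟩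

/-! ## Local evaluation of Prior-LTL formulas -/

/-- The pairs `(d, C)` such that `◇F C` (for `d = true`) or `◇P C` (for `d = false`) occurs in
the given formula, where `□` is read as `¬ ◇ ¬`. -/
def TC.temporals : TC → List (Bool × TC)
  | .neg C => TC.temporals C
  | .and C D => TC.temporals C ++ TC.temporals D
  | .or C D => TC.temporals C ++ TC.temporals D
  | .diamF C => (true, C) :: TC.temporals C
  | .boxF C => (true, .neg C) :: TC.temporals C
  | .diamP C => (false, C) :: TC.temporals C
  | .boxP C => (false, .neg C) :: TC.temporals C
  | _ => []

theorem TC.IsPrior.of_mem_temporals {C : TC} (hC : C.IsPrior) :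
    ∀ x ∈ C.temporals, x.2.IsPrior ∧ x.2.temporals ⊆ C.temporals := by
  induction hC with
  | atom a => simp [TC.temporals]
  | neg _ ih => exact ih
  | and _ _ ih₁ ih₂ | or _ _ ih₁ ih₂ =>
    intro x hx
    rcases List.mem_append.1 hx with hx | hx
    · exact ⟨(ih₁ x hx).1, List.subset_append_of_subset_left _ (ih₁ x hx).2⟩
    · exact ⟨(ih₂ x hx).1, List.subset_append_of_subset_right _ (ih₂ x hx).2⟩
  | boxF h ih | boxP h ih =>
    intro x hx
    rcases List.mem_cons.1 hx with rfl | hx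
    · exact ⟨h.neg, List.subset_cons_self _ _⟩
    · exact ⟨(ih x hx).1, List.subset_cons_of_subset _ (ih x hx).2⟩
  | diamF h ih | diamP h ih =>
    intro x hx
    rcases List.mem_cons.1 hx with rfl | hx
    · exact ⟨h, List.subset_cons_self _ _⟩
    · exact ⟨(ih x hx).1, List.subset_cons_of_subset _ (ih x hx).2⟩

section Local

variable {k : ℕ} (T : Fin k → Bool × TC)

/-- The truth value of a formula at a point, computed from the atoms `v` true at that point and
the position `o` of the point relative to the thresholds of the temporal formulas `T`. -/
def TC.loc (v : ℕ → Prop) (o : Fin k → Ordering) : TC → Prop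
  | .atom a => v a
  | .neg C => ¬ TC.loc v o C
  | .and C D => TC.loc v o C ∧ TC.loc v o D
  | .or C D => TC.loc v o C ∨ TC.loc v o D
  | .diamF C => ∃ i, T i = (true, C) ∧ o i = .lt
  | .boxF C => ¬ ∃ i, T i = (true, .neg C) ∧ o i = .lt
  | .diamP C => ∃ i, T i = (false, C) ∧ o i = .gt
  | .boxP C => ¬ ∃ i, T i = (false, .neg C) ∧ o i = .gt
  | _ => False

theorem TC.loc_congr {v v' : ℕ → Prop} (o : Fin k → Ordering) (C : TC)
    (h : ∀ a ∈ C.atoms, (v a ↔ v' a)) : C.loc T v o ↔ C.loc T v' o := by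
  induction C with
  | atom a => exact h a rfl
  | neg C ih => exact not_congr (ih h)
  | and C D ih₁ ih₂ =>
    exact and_congr (ih₁ fun a ha => h a (.inl ha)) (ih₂ fun a ha => h a (.inr ha))
  | or C D ih₁ ih₂ =>
    exact or_congr (ih₁ fun a ha => h a (.inl ha)) (ih₂ fun a ha => h a (.inr ha))
  | _ => exact Iff.rfl

theorem TC.finite_atoms (C : TC) : C.atoms.Finite := by
  induction C with
  | top => exact Set.finite_empty
  | atom a => exact Set.finite_singleton a
  | and C D ih₁ ih₂ | or C D ih₁ ih₂ | untl C D ih₁ ih₂ | since C D ih₁ ih₂ => exact ih₁.union ih₂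
  | _ => assumption

/-- The atomic concepts true at a time point of an interpretation. -/
def Itp.atomsAt (M : Itp) (n : ℤ) : ℕ → Prop := fun a => n ∈ M a

/-- The position of a time point relative to a family of thresholds. -/
def position (h : Fin k → Threshold) (n : ℤ) : Fin k → Ordering := fun i => (h i).cmp n

variable {T}

theorem TC.IsPrior.loc_iff_sem {M : Itp} {h : Fin k → Threshold} {C : TC} (hC : C.IsPrior)
    (hT : ∀ x ∈ C.temporals, x ∈ Set.range T)
    (hfit : ∀ i, Fits (T i).1 (TC.sem M (T i).2) (h i)) (n : ℤ) :
    C.loc T (M.atomsAt n) (position h n) ↔ n ∈ TC.sem M C := by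
  have fut : ∀ (D : TC), (true, D) ∈ Set.range T →
      ((∃ i, T i = (true, D) ∧ position h n i = .lt) ↔ ∃ k, n < k ∧ k ∈ TC.sem M D) := by
    intro D hD
    have key : ∀ i, T i = (true, D) → (position h n i = .lt ↔ ∃ k, n < k ∧ k ∈ TC.sem M D) := by
      intro i hi
      have := hfit i
      rw [hi] at this
      exact this.cmp_eq_lt_iff n
    obtain ⟨i, hi⟩ := hD
    exact ⟨fun ⟨j, hj, hlt⟩ => (key j hj).1 hlt, fun H => ⟨i, hi, (key i hi).2 H⟩⟩
  have past : ∀ (D : TC), (false, D) ∈ Set.range T →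
      ((∃ i, T i = (false, D) ∧ position h n i = .gt) ↔ ∃ k, k < n ∧ k ∈ TC.sem M D) := by
    intro D hD
    have key : ∀ i, T i = (false, D) → (position h n i = .gt ↔ ∃ k, k < n ∧ k ∈ TC.sem M D) := by
      intro i hi
      have := hfit i
      rw [hi] at this
      exact this.cmp_eq_gt_iff n
    obtain ⟨i, hi⟩ := hD
    exact ⟨fun ⟨j, hj, hlt⟩ => (key j hj).1 hlt, fun H => ⟨i, hi, (key i hi).2 H⟩⟩
  induction hC with
  | atom a => exact Iff.rfl
  | neg _ ih => exact not_congr (ih hT)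
  | and _ _ ih₁ ih₂ =>
    exact and_congr (ih₁ fun x hx => hT x (List.mem_append_left _ hx))
      (ih₂ fun x hx => hT x (List.mem_append_right _ hx))
  | or _ _ ih₁ ih₂ =>
    exact or_congr (ih₁ fun x hx => hT x (List.mem_append_left _ hx))
      (ih₂ fun x hx => hT x (List.mem_append_right _ hx))
  | diamF => exact fut _ (hT _ List.mem_cons_self)
  | diamP => exact past _ (hT _ List.mem_cons_self)
  | boxF => exact (not_congr (fut _ (hT _ List.mem_cons_self))).trans (by simp [TC.sem])
  | boxP => exact (not_congr (past _ (hT _ List.mem_cons_self))).trans (by simp [TC.sem])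

/-- It suffices that the thresholds fit the sets computed by local evaluation. -/
theorem TC.IsPrior.loc_iff_sem_of_fits_loc {M : Itp} {h : Fin k → Threshold}
    (hfit : ∀ i, Fits (T i).1 {n | (T i).2.loc T (M.atomsAt n) (position h n)} (h i))
    {C : TC} (hC : C.IsPrior) (hT : ∀ x ∈ C.temporals, x ∈ Set.range T) (n : ℤ) :
    C.loc T (M.atomsAt n) (position h n) ↔ n ∈ TC.sem M C := by
  have fut : ∀ (D : TC), (true, D) ∈ Set.range T → ∀ n,
      ((∃ i, T i = (true, D) ∧ position h n i = .lt) ↔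
        ∃ k, n < k ∧ D.loc T (M.atomsAt k) (position h k)) := by
    intro D hD n
    have key : ∀ i, T i = (true, D) → (position h n i = .lt ↔
        ∃ k, n < k ∧ D.loc T (M.atomsAt k) (position h k)) := by
      intro i hi
      have := hfit i
      rw [hi] at this
      exact this.cmp_eq_lt_iff n
    obtain ⟨i, hi⟩ := hD
    exact ⟨fun ⟨j, hj, hlt⟩ => (key j hj).1 hlt, fun H => ⟨i, hi, (key i hi).2 H⟩⟩
  have past : ∀ (D : TC), (false, D) ∈ Set.range T → ∀ n,
      ((∃ i, T i = (false, D) ∧ position h n i = .gt) ↔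
        ∃ k, k < n ∧ D.loc T (M.atomsAt k) (position h k)) := by
    intro D hD n
    have key : ∀ i, T i = (false, D) → (position h n i = .gt ↔
        ∃ k, k < n ∧ D.loc T (M.atomsAt k) (position h k)) := by
      intro i hi
      have := hfit i
      rw [hi] at this
      exact this.cmp_eq_gt_iff n
    obtain ⟨i, hi⟩ := hD
    exact ⟨fun ⟨j, hj, hlt⟩ => (key j hj).1 hlt, fun H => ⟨i, hi, (key i hi).2 H⟩⟩
  induction hC generalizing n with
  | atom a => exact Iff.rfl
  | neg _ ih => exact not_congr (ih hT n)
  | and _ _ ih₁ ih₂ =>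
    exact and_congr (ih₁ (fun x hx => hT x (List.mem_append_left _ hx)) n)
      (ih₂ (fun x hx => hT x (List.mem_append_right _ hx)) n)
  | or _ _ ih₁ ih₂ =>
    exact or_congr (ih₁ (fun x hx => hT x (List.mem_append_left _ hx)) n)
      (ih₂ (fun x hx => hT x (List.mem_append_right _ hx)) n)
  | diamF _ ih =>
    exact (fut _ (hT _ List.mem_cons_self) n).trans
      (by simp only [ih fun x hx => hT x (List.mem_cons_of_mem _ hx)]; rfl)
  | diamP _ ih =>
    exact (past _ (hT _ List.mem_cons_self) n).trans
      (by simp only [ih fun x hx => hT x (List.mem_cons_of_mem _ hx)]; rfl)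
  | boxF _ ih =>
    exact (not_congr (fut _ (hT _ List.mem_cons_self) n)).trans
      (by simp [TC.sem, TC.loc, ih fun x hx => hT x (List.mem_cons_of_mem _ hx)])
  | boxP _ ih =>
    exact (not_congr (past _ (hT _ List.mem_cons_self) n)).trans
      (by simp [TC.sem, TC.loc, ih fun x hx => hT x (List.mem_cons_of_mem _ hx)])

variable (T)

/-- A point with atoms `v` and position `o` satisfies the ontology and the conditions imposed by
the thresholds. -/
def Admissible (O : List TC) (v : ℕ → Prop) (o : Fin k → Ordering) : Prop :=
  (∀ C ∈ O, C.loc T v o) ∧ ∀ i, PointFits (T i).1 (o i) ((T i).2.loc T v o)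

/-- There is an admissible left half-line `n < 0` on which exactly the thresholds `i` with
`s i = .gt` lie. -/
def LeftExtendable (O : List TC) (s : Fin k → Ordering) : Prop :=
  ∃ (M : Itp) (h : Fin k → Threshold), (∀ i, s i = .gt ↔ (h i).cmp 0 = .gt) ∧
    (∀ n < 0, Admissible T O (M.atomsAt n) (position h n)) ∧
    ∀ i, (T i).1 = false → h i = .neg →
      ∀ n, ∃ k, k < n ∧ (T i).2.loc T (M.atomsAt k) (position h k)

/-- There is an admissible right half-line `n > 0` on which exactly the thresholds `i` with
`s i = .lt` lie. -/
def RightExtendable (O : List TC) (s : Fin k → Ordering) : Prop :=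
  ∃ (M : Itp) (h : Fin k → Threshold), (∀ i, s i = .lt ↔ (h i).cmp 0 = .lt) ∧
    (∀ n > 0, Admissible T O (M.atomsAt n) (position h n)) ∧
    ∀ i, (T i).1 = true → h i = .pos →
      ∀ n, ∃ k, n < k ∧ (T i).2.loc T (M.atomsAt k) (position h k)

/-- The position of `n` in the active domain: the thresholds `i` with `s i = .eq` lie inside the
active domain, at `g i`, and the others outside. -/
def innerPosition (s : Fin k → Ordering) (g : Fin k → ℤ) (n : ℤ) : Fin k → Ordering :=
  fun i => if s i = .eq then compare n (g i) else s i

/-- The data can be extended to an admissible interval falsifying `κ` at `ℓ`. -/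
def InnerExtendable (O : List TC) (κ : TC) (s : Fin k → Ordering) (A : DataInstance) (ℓ : ℤ) :
    Prop :=
  ∃ g : Fin k → ℤ, (∀ i, g i ∈ A.tem) ∧ ∀ n ∈ A.tem, ∃ v : ℕ → Prop,
    (∀ a, n ∈ A.itp a → v a) ∧ Admissible T O v (innerPosition s g n) ∧
      (n = ℓ → ¬ κ.loc T v (innerPosition s g n))

end Local

/-! ## Splitting and gluing countermodels -/

theorem DataInstance.minT_eq (A : DataInstance) : A.minT = 0 := by
  apply le_antisymm
  · obtain ⟨p, hp, h0⟩ := A.has_zero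
    exact h0 ▸ Finset.min'_le _ _ (Finset.mem_image_of_mem _ hp)
  · apply Finset.le_min'
    intro y hy
    obtain ⟨p, hp, rfl⟩ := Finset.mem_image.1 hy
    exact A.nonneg p hp

theorem DataInstance.maxT_nonneg (A : DataInstance) : 0 ≤ A.maxT := by
  obtain ⟨p, hp, h0⟩ := A.has_zero
  exact h0 ▸ Finset.le_max' _ _ (Finset.mem_image_of_mem _ hp)

theorem DataInstance.mem_tem {A : DataInstance} {n : ℤ} : n ∈ A.tem ↔ 0 ≤ n ∧ n ≤ A.maxT := by
  rw [DataInstance.tem, A.minT_eq, Set.mem_Icc]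

theorem DataInstance.mem_tem_of_mem {A : DataInstance} {p : ℕ × ℤ} (hp : p ∈ A.atoms) :
    p.2 ∈ A.tem :=
  DataInstance.mem_tem.2
    ⟨A.nonneg p hp, Finset.le_max' _ _ (Finset.mem_image_of_mem _ hp)⟩

section Glue

variable {k : ℕ} {T : Fin k → Bool × TC} {O : List TC} {κ : TC}

/-- Restriction of a countermodel to the active domain and the two half-lines around it. -/
theorem exists_extendable_of_countermodel
    (hTP : ∀ i, (T i).2.IsPrior) (hTT : ∀ i, ∀ x ∈ (T i).2.temporals, x ∈ Set.range T)
    (hO : ∀ C ∈ O, C.IsPrior) (hOT : ∀ C ∈ O, ∀ x ∈ C.temporals, x ∈ Set.range T)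
    (hκ : κ.IsPrior) (hκT : ∀ x ∈ κ.temporals, x ∈ Set.range T)
    {A : DataInstance} {ℓ : ℤ} {M : Itp} (hM : ∀ C ∈ O, ∀ n : ℤ, n ∈ TC.sem M C)
    (hA : ∀ p ∈ A.atoms, p.2 ∈ M p.1) (hℓ : ℓ ∉ TC.sem M κ) :
    ∃ s, LeftExtendable T O s ∧ RightExtendable T O s ∧ InnerExtendable T O κ s A ℓ := by
  choose h hfit using fun i => exists_fits (T i).1 (TC.sem M (T i).2)
  have hloc : ∀ i n, (T i).2.loc T (M.atomsAt n) (position h n) ↔ n ∈ TC.sem M (T i).2 :=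
    fun i => (hTP i).loc_iff_sem (hTT i) hfit
  have hadm : ∀ n, Admissible T O (M.atomsAt n) (position h n) := fun n =>
    ⟨fun C hC => ((hO C hC).loc_iff_sem (hOT C hC) hfit n).2 (hM C hC n),
      fun i => by rw [hloc]; exact (hfit i).1 n⟩
  have hm := A.maxT_nonneg
  set m := A.maxT with hmdef
  set s : Fin k → Ordering := fun i =>
    if (h i).cmp 0 = .gt then .gt else if (h i).cmp m = .lt then .lt else .eq with hs
  have hgt : ∀ i, s i = .gt ↔ (h i).cmp 0 = .gt := by
    intro i
    simp only [hs]
    split_ifs <;> simp_all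
  have hlt : ∀ i, s i = .lt ↔ (h i).cmp m = .lt := by
    intro i
    simp only [hs]
    split_ifs with h₁ h₂
    · simp only [false_iff]
      intro h₂
      rcases hm.eq_or_lt with h0 | h0
      · rw [← h0, h₁] at h₂
        cases h₂
      · rw [Threshold.cmp_lt_of_lt h0 (by simp [h₂])] at h₁
        cases h₁
    · simp [h₂]
    · simp [h₂]
  refine ⟨s, ⟨M, h, hgt, fun n _ => hadm n, fun i hd hi n => ?_⟩, ?_, ?_⟩
  · simp only [hloc]
    exact (hfit i).2.2 hd hi n
  · have hat : ∀ n, Itp.atomsAt (fun a => {n | n + m ∈ M a}) n = M.atomsAt (n + m) := fun n => rfl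
    have hpos : ∀ n, position (fun i => (h i).shift (-m)) n = position h (n + m) := by
      intro n
      funext i
      simp [position, Threshold.cmp_shift]
    refine ⟨fun a => {n | n + m ∈ M a}, fun i => (h i).shift (-m), fun i => ?_, fun n _ => ?_,
      fun i hd hi n => ?_⟩
    · rw [hlt, Threshold.cmp_shift]
      simp
    · rw [hat, hpos]
      exact hadm _
    · have hi' : h i = .pos := by
        cases hh : h i <;> simp_all [Threshold.shift]
      obtain ⟨j, hj, hjX⟩ := (hfit i).2.1 hd hi' (n + m)
      refine ⟨j - m, by omega, ?_⟩
      rw [hat, hpos, sub_add_cancel, hloc]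
      exact hjX
  · have hg : ∀ i, ∃ x ∈ A.tem, s i = .eq → h i = .fin x := by
      intro i
      by_cases hsi : s i = .eq
      · have h₁ : (h i).cmp 0 ≠ .gt := by rw [ne_eq, ← hgt, hsi]; simp
        have h₂ : (h i).cmp m ≠ .lt := by rw [ne_eq, ← hlt, hsi]; simp
        cases hh : h i with
        | neg => rw [hh] at h₁; exact absurd rfl h₁
        | pos => rw [hh] at h₂; exact absurd rfl h₂
        | fin x =>
          rw [hh] at h₁ h₂
          simp only [Threshold.cmp, ne_eq, compare_gt_iff_gt, compare_lt_iff_lt] at h₁ h₂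
          exact ⟨x, DataInstance.mem_tem.2 (by omega), fun _ => rfl⟩
      · exact ⟨0, DataInstance.mem_tem.2 (by omega), fun H => absurd H hsi⟩
    choose g hg₁ hg₂ using hg
    refine ⟨g, hg₁, fun n hn => ⟨M.atomsAt n, fun a ha => hA (a, n) ha, ?_⟩⟩
    have hn' := DataInstance.mem_tem.1 hn
    have hpos : innerPosition s g n = position h n := by
      funext i
      simp only [innerPosition, position]
      split_ifs with hsi
      · rw [hg₂ i hsi]
        rfl
      · cases hsi' : s i with
        | eq => exact absurd hsi' hsi
        | lt =>
          have := (hlt i).1 hsi'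
          rcases hn'.2.eq_or_lt with h0 | h0
          · rw [h0, this]
          · rw [Threshold.cmp_lt_of_lt h0 (by simp [← hmdef, this])]
        | gt =>
          have := (hgt i).1 hsi'
          rcases hn'.1.eq_or_lt with h0 | h0
          · rw [← h0, this]
          · rw [Threshold.cmp_gt_of_lt h0 (by simp [this])]
    rw [hpos]
    refine ⟨hadm n, ?_⟩
    rintro rfl
    rwa [hκ.loc_iff_sem hκT hfit]

/-- Gluing the active domain and the two half-lines around it to a countermodel. -/
theorem exists_countermodel_of_extendable
    (hO : ∀ C ∈ O, C.IsPrior) (hOT : ∀ C ∈ O, ∀ x ∈ C.temporals, x ∈ Set.range T)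
    (hκ : κ.IsPrior) (hκT : ∀ x ∈ κ.temporals, x ∈ Set.range T)
    {A : DataInstance} {ℓ : ℤ} (hℓ : ℓ ∈ A.tem) {s : Fin k → Ordering}
    (hL : LeftExtendable T O s) (hR : RightExtendable T O s)
    (hI : InnerExtendable T O κ s A ℓ) :
    ∃ M : Itp, (∀ C ∈ O, ∀ n : ℤ, n ∈ TC.sem M C) ∧ (∀ p ∈ A.atoms, p.2 ∈ M p.1) ∧
      ℓ ∉ TC.sem M κ := by
  obtain ⟨ML, hl, hsL, hadmL, hlimL⟩ := hL
  obtain ⟨MR, hr, hsR, hadmR, hlimR⟩ := hR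
  obtain ⟨g, hg, hI⟩ := hI
  choose! v hdata hadmI hκI using hI
  have hm := A.maxT_nonneg
  set m := A.maxT with hmdef
  let M : Itp := fun a => {n | if n < 0 then n ∈ ML a else if n ≤ m then v n a else n - m ∈ MR a}
  let h : Fin k → Threshold := fun i =>
    match s i with
    | .gt => hl i
    | .eq => .fin (g i)
    | .lt => (hr i).shift m
  have hgt : ∀ i, s i = .gt → h i = hl i := fun i hi => by simp [h, hi]
  have heq : ∀ i, s i = .eq → h i = .fin (g i) := fun i hi => by simp [h, hi]
  have hlt : ∀ i, s i = .lt → h i = (hr i).shift m := fun i hi => by simp [h, hi]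
  have hMl : ∀ n < 0, M.atomsAt n = ML.atomsAt n := by
    intro n hn
    funext a
    simp [M, Itp.atomsAt, hn]
  have hMi : ∀ n ∈ A.tem, M.atomsAt n = v n := by
    intro n hn
    obtain ⟨h₁, h₂⟩ := DataInstance.mem_tem.1 hn
    funext a
    simp [M, Itp.atomsAt, not_lt.2 h₁, hmdef, h₂]
  have hMr : ∀ n, m < n → M.atomsAt n = MR.atomsAt (n - m) := by
    intro n hn
    funext a
    simp [M, Itp.atomsAt, not_lt.2 (hm.trans hn.le), not_le.2 hn]
  have hpl : ∀ n < 0, position h n = position hl n := by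
    intro n hn
    funext i
    simp only [position]
    cases hsi : s i with
    | gt => rw [hgt i hsi]
    | eq =>
      have h₁ := DataInstance.mem_tem.1 (hg i)
      rw [Threshold.cmp_lt_of_lt (h := hl i) hn fun H => by simp [(hsL i).2 H] at hsi, heq i hsi]
      exact compare_lt_iff_lt.2 (by omega)
    | lt =>
      rw [Threshold.cmp_lt_of_lt (h := hl i) hn fun H => by simp [(hsL i).2 H] at hsi, hlt i hsi,
        Threshold.cmp_shift]
      exact Threshold.cmp_lt_of_lt (by omega : n - m < 0) (by simp [(hsR i).1 hsi])
  have hpr : ∀ n, m < n → position h n = position hr (n - m) := by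
    intro n hn
    have hn' : 0 < n - m := by omega
    funext i
    simp only [position]
    cases hsi : s i with
    | lt => rw [hlt i hsi, Threshold.cmp_shift]
    | eq =>
      have h₁ := DataInstance.mem_tem.1 (hg i)
      rw [Threshold.cmp_gt_of_lt (h := hr i) hn' fun H => by simp [(hsR i).2 H] at hsi, heq i hsi]
      exact compare_gt_iff_gt.2 (by omega)
    | gt =>
      rw [Threshold.cmp_gt_of_lt (h := hr i) hn' fun H => by simp [(hsR i).2 H] at hsi, hgt i hsi]
      exact Threshold.cmp_gt_of_lt (by omega : 0 < n) (by simp [(hsL i).1 hsi])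
  have hpi : ∀ n ∈ A.tem, position h n = innerPosition s g n := by
    intro n hn
    obtain ⟨h₁, h₂⟩ := DataInstance.mem_tem.1 hn
    funext i
    simp only [position, innerPosition]
    cases hsi : s i with
    | eq => rw [heq i hsi]; rfl
    | gt =>
      have := (hsL i).1 hsi
      rw [hgt i hsi]
      rcases h₁.eq_or_lt with h0 | h0
      · simp [← h0, this]
      · simp [Threshold.cmp_gt_of_lt (h := hl i) h0 (by simp [this])]
    | lt =>
      have := (hsR i).1 hsi
      rw [hlt i hsi, Threshold.cmp_shift]
      rcases h₂.eq_or_lt with h0 | h0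
      · simp [h0, ← hmdef, this]
      · simp [Threshold.cmp_lt_of_lt (h := hr i) (by omega : n - m < 0) (by simp [this])]
  have hadm : ∀ n, Admissible T O (M.atomsAt n) (position h n) := by
    intro n
    by_cases h₁ : n < 0
    · rw [hMl n h₁, hpl n h₁]
      exact hadmL n h₁
    by_cases h₂ : n ≤ m
    · have hn : n ∈ A.tem := DataInstance.mem_tem.2 (by omega)
      rw [hMi n hn, hpi n hn]
      exact hadmI n hn
    · rw [hMr n (by omega), hpr n (by omega)]
      exact hadmR (n - m) (by omega)
  have hfit : ∀ i, Fits (T i).1 {n | (T i).2.loc T (M.atomsAt n) (position h n)} (h i) := by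
    refine fun i => ⟨fun n => (hadm n).2 i, fun hd hi n => ?_, fun hd hi n => ?_⟩
    · have hsi : s i = .lt := by
        cases hsi : s i with
        | lt => rfl
        | eq => rw [heq i hsi] at hi; cases hi
        | gt =>
          have := (hsL i).1 hsi
          rw [← hgt i hsi, hi] at this
          cases this
      have hri : hr i = .pos := by
        rw [hlt i hsi] at hi
        cases hh : hr i <;> simp_all [Threshold.shift]
      obtain ⟨j, hj, hjX⟩ := hlimR i hd hri (max (n - m) 0)
      have h₁ : m < j + m := by omega
      refine ⟨j + m, by omega, ?_⟩
      rw [Set.mem_ofPred_eq, hMr _ h₁, hpr _ h₁, add_sub_cancel_right]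
      exact hjX
    · have hsi : s i = .gt := by
        cases hsi : s i with
        | gt => rfl
        | eq => rw [heq i hsi] at hi; cases hi
        | lt =>
          have := (hsR i).1 hsi
          rw [hlt i hsi] at hi
          cases hh : hr i <;> simp_all [Threshold.shift, Threshold.cmp]
      obtain ⟨j, hj, hjX⟩ := hlimL i hd (by rw [← hgt i hsi, hi]) (min n 0)
      have h₁ : j < 0 := by omega
      refine ⟨j, by omega, ?_⟩
      rw [Set.mem_ofPred_eq, hMl _ h₁, hpl _ h₁]
      exact hjX
  refine ⟨M, fun C hC n => ?_, fun p hp => ?_, ?_⟩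
  · exact (TC.IsPrior.loc_iff_sem_of_fits_loc hfit (hO C hC) (hOT C hC) n).1 ((hadm n).1 C hC)
  · have hp' := DataInstance.mem_tem_of_mem hp
    change M.atomsAt p.2 p.1
    rw [hMi _ hp']
    exact hdata p.2 hp' p.1 hp
  · rw [← TC.IsPrior.loc_iff_sem_of_fits_loc hfit hκ hκT, hMi ℓ hℓ, hpi ℓ hℓ]
    exact hκI ℓ hℓ rfl

end Glue

/-! ## FO(<)-definable properties of data instances -/

/-- A property of data instances and assignments is FO(<)-definable by a formula whose free
variables belong to `V`. -/
def FOltDefinable (V : Set ℕ) (R : DataInstance → (ℕ → ℤ) → Prop) : Prop :=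
  ∃ φ : Fml, φ.IsFOlt ∧ φ.fvars ⊆ V ∧ ∀ A env, Fml.evalIn A.tem A.itp φ env ↔ R A env

namespace FOltDefinable

variable {V : Set ℕ} {R S : DataInstance → (ℕ → ℤ) → Prop}

theorem congr (h : FOltDefinable V R) (hRS : ∀ A env, R A env ↔ S A env) : FOltDefinable V S := by
  obtain ⟨φ, h₁, h₂, h₃⟩ := h
  exact ⟨φ, h₁, h₂, fun A env => (h₃ A env).trans (hRS A env)⟩

theorem not (h : FOltDefinable V R) : FOltDefinable V fun A env => ¬ R A env := by
  obtain ⟨φ, h₁, h₂, h₃⟩ := h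
  exact ⟨.neg φ, h₁, h₂, fun A env => not_congr (h₃ A env)⟩

theorem and (hR : FOltDefinable V R) (hS : FOltDefinable V S) :
    FOltDefinable V fun A env => R A env ∧ S A env := by
  obtain ⟨φ, h₁, h₂, h₃⟩ := hR
  obtain ⟨ψ, h₁', h₂', h₃'⟩ := hS
  exact ⟨.and φ ψ, ⟨h₁, h₁'⟩, Set.union_subset h₂ h₂',
    fun A env => and_congr (h₃ A env) (h₃' A env)⟩

theorem or (hR : FOltDefinable V R) (hS : FOltDefinable V S) :
    FOltDefinable V fun A env => R A env ∨ S A env :=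
  (hR.not.and hS.not).not.congr fun _ _ => by tauto

theorem imp (hR : FOltDefinable V R) (hS : FOltDefinable V S) :
    FOltDefinable V fun A env => R A env → S A env :=
  (hR.not.or hS).congr fun _ _ => by tauto

theorem const (p : Prop) : FOltDefinable V fun _ _ => p := by
  have hF : FOltDefinable V fun _ _ => False :=
    ⟨.falsum, trivial, Set.empty_subset _, fun _ _ => Iff.rfl⟩
  by_cases hp : p
  · exact hF.not.congr fun _ _ => by simp [hp]
  · exact hF.congr fun _ _ => by simp [hp]

theorem atom (a : ℕ) {x : ℕ} (hx : x ∈ V) : FOltDefinable V fun A env => env x ∈ A.itp a :=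
  ⟨.atom a x, trivial, Set.singleton_subset_iff.2 hx, fun _ _ => Iff.rfl⟩

theorem eq {x y : ℕ} (hx : x ∈ V) (hy : y ∈ V) : FOltDefinable V fun _ env => env x = env y :=
  ⟨.eq x y, trivial, Set.insert_subset hx (Set.singleton_subset_iff.2 hy), fun _ _ => Iff.rfl⟩

theorem lt {x y : ℕ} (hx : x ∈ V) (hy : y ∈ V) : FOltDefinable V fun _ env => env x < env y :=
  ⟨.lt x y, trivial, Set.insert_subset hx (Set.singleton_subset_iff.2 hy), fun _ _ => Iff.rfl⟩

theorem compare_eq {x y : ℕ} (hx : x ∈ V) (hy : y ∈ V) (c : Ordering) :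
    FOltDefinable V fun _ env => compare (env x) (env y) = c := by
  cases c with
  | lt => exact (lt hx hy).congr fun _ _ => compare_lt_iff_lt.symm
  | eq => exact (eq hx hy).congr fun _ _ => compare_eq_iff_eq.symm
  | gt => exact (lt hy hx).congr fun _ _ => compare_gt_iff_gt.symm

theorem ex (x : ℕ) (hR : FOltDefinable (insert x V) R) :
    FOltDefinable V fun A env => ∃ d ∈ A.tem, R A (Function.update env x d) := by
  obtain ⟨φ, h₁, h₂, h₃⟩ := hR
  refine ⟨.ex x φ, h₁, ?_, fun A env => exists_congr fun d => and_congr_right fun _ => h₃ A _⟩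
  rintro y ⟨hy, hyx⟩
  exact (h₂ hy).resolve_left hyx

theorem all (x : ℕ) (hR : FOltDefinable (insert x V) R) :
    FOltDefinable V fun A env => ∀ d ∈ A.tem, R A (Function.update env x d) :=
  (hR.not.ex x).not.congr fun _ _ => by push Not; rfl

theorem iForall {ι : Type*} [Finite ι] {R : ι → DataInstance → (ℕ → ℤ) → Prop}
    (hR : ∀ i, FOltDefinable V (R i)) : FOltDefinable V fun A env => ∀ i, R i A env := by
  cases nonempty_fintype ι
  have key : ∀ l : List ι, FOltDefinable V fun A env => ∀ i ∈ l, R i A env := by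
    intro l
    induction l with
    | nil => exact (const True).congr fun _ _ => by simp
    | cons i l ih => exact ((hR i).and ih).congr fun _ _ => by simp
  exact (key Finset.univ.toList).congr fun _ _ => by simp

theorem iExists {ι : Type*} [Finite ι] {R : ι → DataInstance → (ℕ → ℤ) → Prop}
    (hR : ∀ i, FOltDefinable V (R i)) : FOltDefinable V fun A env => ∃ i, R i A env :=
  (iForall fun i => (hR i).not).not.congr fun _ _ => by push Not; rfl

/-- Existential quantification over the block of variables `2, …, k + 1`. -/
theorem exBlock (k : ℕ) (hR : FOltDefinable (V ∪ Set.Ico 2 (k + 2)) R) :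
    FOltDefinable V fun A env => ∃ env' : ℕ → ℤ, (∀ j ∉ Set.Ico 2 (k + 2), env' j = env j) ∧
      (∀ j ∈ Set.Ico 2 (k + 2), env' j ∈ A.tem) ∧ R A env' := by
  induction k generalizing R with
  | zero =>
    simp only [zero_add, Set.Ico_self, Set.union_empty] at hR
    refine hR.congr fun A env => ⟨fun h => ⟨env, by simpa using h⟩, ?_⟩
    rintro ⟨env', h, -, h'⟩
    have : env' = env := funext fun j => h j (by simp)
    rwa [← this]
  | succ k ih =>
    have hset : V ∪ Set.Ico 2 (k + 1 + 2) = insert (k + 2) (V ∪ Set.Ico 2 (k + 2)) := by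
      ext j
      simp only [Set.mem_union, Set.mem_insert_iff, Set.mem_Ico]
      by_cases hj : j ∈ V <;> simp only [hj, true_or, or_true, false_or]
      omega
    rw [hset] at hR
    refine (ih (hR.ex (k + 2))).congr fun A env => ⟨?_, ?_⟩
    · rintro ⟨env', h₁, h₂, d, hd, h₃⟩
      refine ⟨Function.update env' (k + 2) d, fun j hj => ?_, fun j hj => ?_, h₃⟩
      · simp only [Set.mem_Ico] at hj
        rw [Function.update_of_ne (by omega)]
        exact h₁ j (by simp only [Set.mem_Ico]; omega)
      · rcases eq_or_ne j (k + 2) with rfl | hne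
        · simpa using hd
        · rw [Function.update_of_ne hne]
          simp only [Set.mem_Ico] at hj
          exact h₂ j (by simp only [Set.mem_Ico]; omega)
    · rintro ⟨env', h₁, h₂, h₃⟩
      refine ⟨Function.update env' (k + 2) (env (k + 2)), fun j hj => ?_, fun j hj => ?_,
        env' (k + 2), h₂ _ (by simp only [Set.mem_Ico]; omega), by simpa using h₃⟩
      · rcases eq_or_ne j (k + 2) with rfl | hne
        · simp
        · rw [Function.update_of_ne hne]
          simp only [Set.mem_Ico] at hj
          exact h₁ j (by simp only [Set.mem_Ico]; omega)
      · simp only [Set.mem_Ico] at hj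
        rw [Function.update_of_ne (by omega)]
        exact h₂ j (by simp only [Set.mem_Ico]; omega)

end FOltDefinable

theorem foltDefinable_innerExtendable {k : ℕ} (T : Fin k → Bool × TC) (O : List TC) (κ : TC)
    (s : Fin k → Ordering) :
    FOltDefinable {0} fun A env => InnerExtendable T O κ s A (env 0) := by
  let At : Set ℕ := (⋃ C ∈ {C | C ∈ O}, C.atoms) ∪ (κ.atoms ∪ ⋃ i, (T i).2.atoms)
  have hfin : Finite At :=
    ((O.finite_toSet.biUnion fun C _ => C.finite_atoms).union
      (κ.finite_atoms.union (Set.finite_iUnion fun i => (T i).2.finite_atoms))).to_subtype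
  let val : Set At → ℕ → Prop := fun S a => ∀ ha : a ∈ At, (⟨a, ha⟩ : At) ∈ S
  have hval : ∀ (C : TC), C.atoms ⊆ At → ∀ (v : ℕ → Prop) (o : Fin k → Ordering),
      (C.loc T (val {a | v a}) o ↔ C.loc T v o) := by
    intro C hC v o
    refine TC.loc_congr T o C fun a ha => ?_
    have := hC ha
    simp [val, this]
  have hAdm : ∀ (v : ℕ → Prop) (o : Fin k → Ordering),
      (Admissible T O (val {a | v a}) o ↔ Admissible T O v o) := by
    intro v o
    refine and_congr (forall₂_congr fun C hC => hval C ?_ v o) (forall_congr' fun i => ?_)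
    · exact fun a ha => .inl (Set.mem_biUnion (show C ∈ {C | C ∈ O} from hC) ha)
    · rw [hval (T i).2 fun a ha => .inr (.inr (Set.mem_iUnion_of_mem i ha))]
  have hκ : κ.atoms ⊆ At := fun a ha => .inr (.inl ha)
  have hpoint : FOltDefinable (insert 1 ({0} ∪ Set.Ico 2 (k + 2))) fun A env =>
      ∃ o : Fin k → Ordering,
        (∀ i, (if s i = .eq then compare (env 1) (env (i + 2)) else s i) = o i) ∧
        ∃ S : Set At, (∀ a : At, env 1 ∈ A.itp a → a ∈ S) ∧ Admissible T O (val S) o ∧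
          (env 1 = env 0 → ¬ κ.loc T (val S) o) := by
    refine .iExists fun o => .and (.iForall fun i => ?_) (.iExists fun S =>
      .and (.iForall fun a => .imp (.atom _ (by simp)) (.const _))
        (.and (.const _) (.imp (.eq (by simp) (by simp)) (.const _))))
    split_ifs
    · exact .compare_eq (by simp) (by simp) _
    · exact .const _
  refine ((hpoint.all 1).exBlock k).congr fun A env => ⟨?_, ?_⟩
  · rintro ⟨env', h₁, h₂, h₃⟩
    refine ⟨fun i => env' (i + 2), fun i => h₂ _ (by simp), fun n hn => ?_⟩
    obtain ⟨o, ho, S, hS, hadm, hloc⟩ := h₃ n hn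
    have ho' : innerPosition s (fun i => env' (i + 2)) n = o := by
      funext i
      simpa [innerPosition] using ho i
    refine ⟨val S, fun a ha h => hS ⟨a, h⟩ (by simpa using ha), ho' ▸ hadm, ?_⟩
    rw [ho']
    intro hnl
    exact hloc (by simpa [h₁ 0 (by simp)] using hnl)
  · rintro ⟨g, hg, h⟩
    let env' : ℕ → ℤ := fun j => if hj : 2 ≤ j ∧ j - 2 < k then g ⟨j - 2, hj.2⟩ else env j
    have henv : ∀ i : Fin k, env' (i + 2) = g i := fun i => by simp [env']
    refine ⟨env', fun j hj => ?_, fun j hj => ?_, fun n hn => ?_⟩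
    · simp only [Set.mem_Ico] at hj
      exact dif_neg (by omega)
    · simp only [Set.mem_Ico] at hj
      simp only [env', dif_pos (show 2 ≤ j ∧ j - 2 < k by omega)]
      exact hg _
    · obtain ⟨v, hv, hadm, hloc⟩ := h n hn
      refine ⟨innerPosition s g n, fun i => ?_, {a | v a}, fun a ha => hv a (by simpa using ha),
        (hAdm _ _).2 hadm, fun hnl => ?_⟩
      · simp [innerPosition, henv]
      · rw [hval κ hκ]
        exact hloc (by simpa [env'] using hnl)

/-- Theorem A: FO(<)-rewritability of Prior-LTL OMQs.
For a Prior-LTL ontology `O` (a finite set of Prior-LTL formulas, each required to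
hold at every time point) and a Prior-LTL query `κ`, the OMQ `(O, κ)` is
FO(<)-rewritable. -/
theorem prior_OMQ_FOlt_rewritable (O : List TC) (hO : ∀ C ∈ O, C.IsPrior)
    (κ : TC) (hκ : κ.IsPrior) :
    ∃ φ : Fml, φ.IsFOlt ∧ φ.fvars ⊆ {0} ∧
      ∀ A : DataInstance,
        {ℓ | ℓ ∈ A.tem ∧ ∀ M : Itp,
            ((∀ C ∈ O, ∀ n : ℤ, n ∈ TC.sem M C) ∧ ∀ p ∈ A.atoms, p.2 ∈ M p.1) →
              ℓ ∈ TC.sem M κ}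
          = {ℓ ∈ A.tem | Fml.evalIn A.tem A.itp φ (fun _ => ℓ)} := by
  classical
  let L : List (Bool × TC) := (κ :: O).flatMap TC.temporals
  let T : Fin L.length → Bool × TC := L.get
  have hT : ∀ x, x ∈ Set.range T ↔ x ∈ L := fun x => by simp [T, List.mem_iff_get]
  have hP : ∀ C ∈ κ :: O, C.IsPrior := by simpa using ⟨hκ, hO⟩
  have hsub : ∀ C ∈ κ :: O, ∀ x ∈ C.temporals, x ∈ Set.range T := fun C hC x hx =>
    (hT x).2 (List.mem_flatMap.2 ⟨C, hC, hx⟩)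
  have hTi : ∀ i, (T i).2.IsPrior ∧ ∀ x ∈ (T i).2.temporals, x ∈ Set.range T := by
    intro i
    obtain ⟨C, hC, hi⟩ := List.mem_flatMap.1 ((hT _).1 (Set.mem_range_self i))
    obtain ⟨h₁, h₂⟩ := (hP C hC).of_mem_temporals _ hi
    exact ⟨h₁, fun x hx => hsub C hC x (h₂ hx)⟩
  have hOT : ∀ C ∈ O, ∀ x ∈ C.temporals, x ∈ Set.range T := fun C hC =>
    hsub C (List.mem_cons_of_mem _ hC)
  have hκT := hsub κ List.mem_cons_self
  obtain ⟨φ, h₁, h₂, h₃⟩ : FOltDefinable {0} fun A env => ¬ ∃ s,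
      LeftExtendable T O s ∧ RightExtendable T O s ∧ InnerExtendable T O κ s A (env 0) :=
    .not (.iExists fun s => .and (.const _) (.and (.const _)
      (foltDefinable_innerExtendable T O κ s)))
  refine ⟨φ, h₁, h₂, fun A => Set.ext fun ℓ => and_congr_right fun hℓ => ?_⟩
  rw [h₃, ← not_iff_not, not_not]
  constructor
  · intro h
    push Not at h
    obtain ⟨M, ⟨hM, hA⟩, hℓκ⟩ := h
    exact exists_extendable_of_countermodel (fun i => (hTi i).1) (fun i => (hTi i).2) hO hOT
      hκ hκT hM hA hℓκ
  · rintro ⟨s, hL, hR, hI⟩ h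
    obtain ⟨M, hM, hA, hℓκ⟩ := exists_countermodel_of_extendable hO hOT hκ hκT hℓ hL hR hI
    exact hℓκ (h M ⟨hM, hA⟩)

end LTLOMQ
end

section
/- Let O be a consistent LTL_krom^○ ontology without nested temporal operators, let A be an atomic concept occurring in O, and let q = (O, A). For every data instance A consistent with O and every ℓ ∈ ℤ: ℓ ∈ ans^ℤ(q, A) if and only if (B, n) ⇝ (A, ℓ) for some B(n) ∈ A. -/
namespace LTLOMQ

theorem TC.mem_sem_iterF (M : Itp) (C : TC) (k : ℕ) (n : ℤ) :
    n ∈ TC.sem M (TC.iterF k C) ↔ n + k ∈ TC.sem M C := by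
  induction k generalizing n with
  | zero => simp [TC.iterF]
  | succ k ih =>
    have h : n + 1 + (k : ℤ) = n + ((k + 1 : ℕ) : ℤ) := by push_cast; ring
    simp only [TC.iterF, TC.sem, Set.mem_ofPred_eq, ih, h]

theorem TC.mem_sem_iterP (M : Itp) (C : TC) (k : ℕ) (n : ℤ) :
    n ∈ TC.sem M (TC.iterP k C) ↔ n - k ∈ TC.sem M C := by
  induction k generalizing n with
  | zero => simp [TC.iterP]
  | succ k ih =>
    have h : n - 1 - (k : ℤ) = n - ((k + 1 : ℕ) : ℤ) := by push_cast; ring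
    simp only [TC.iterP, TC.sem, Set.mem_ofPred_eq, ih, h]

theorem TC.mem_sem_shift (M : Itp) (C : TC) (k n : ℤ) :
    n ∈ TC.sem M (TC.shift k C) ↔ n + k ∈ TC.sem M C := by
  unfold TC.shift
  split_ifs with h
  · rw [TC.mem_sem_iterF, Int.toNat_of_nonneg h]
  · rw [TC.mem_sem_iterP, Int.toNat_of_nonneg (by omega), sub_neg_eq_add]

/-- For positive literals, `⇝` says that `n + n₁ ∈ M a` implies `n + n₂ ∈ M b`
in every model `M` of the ontology. -/
theorem leadsTo_pos_iff (O : Ontology) (a b : ℕ) (n₁ n₂ : ℤ) :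
    leadsTo O (a, true) n₁ (b, true) n₂ ↔
      ∀ M : Itp, (∀ cl ∈ O, cl.holds M) → ∀ n : ℤ, n + n₁ ∈ M a → n + n₂ ∈ M b := by
  simp [leadsTo, Set.subset_def, TC.mem_sem_shift, Lit.toTC, TC.sem]

/-- The translation of an interpretation by `m`. -/
def Itp.translate (M : Itp) (m : ℤ) : Itp := fun a => {n | n + m ∈ M a}

theorem TC.IsBasicNext.mem_sem_translate {C : TC} (hC : C.IsBasicNext) (M : Itp) (m n : ℤ) :
    n ∈ TC.sem (M.translate m) C ↔ n + m ∈ TC.sem M C := by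
  induction hC generalizing n with
  | atom a => rfl
  | nextF _ ih => simp only [TC.sem, Set.mem_ofPred_eq, ih, add_right_comm]
  | nextP _ ih => simp only [TC.sem, Set.mem_ofPred_eq, ih, sub_add_eq_add_sub]

theorem Clause.holds.translate {cl : Clause} (hcl : cl.AllBasicNext) {M : Itp}
    (h : cl.holds M) (m : ℤ) : cl.holds (M.translate m) := by
  intro n hn
  obtain ⟨C, hC, hCn⟩ :=
    h (n + m) fun C hC => ((hcl.1 C hC).mem_sem_translate M m n).1 (hn C hC)
  exact ⟨C, hC, ((hcl.2 C hC).mem_sem_translate M m n).2 hCn⟩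

/-- The pointwise majority of three interpretations. -/
def Itp.majority (M₁ M₂ M₃ : Itp) : Itp :=
  fun a => M₁ a ∩ M₂ a ∪ M₁ a ∩ M₃ a ∪ M₂ a ∩ M₃ a

theorem TC.IsBasicNext.sem_majority {C : TC} (hC : C.IsBasicNext) (M₁ M₂ M₃ : Itp) :
    TC.sem (Itp.majority M₁ M₂ M₃) C =
      TC.sem M₁ C ∩ TC.sem M₂ C ∪ TC.sem M₁ C ∩ TC.sem M₃ C ∪ TC.sem M₂ C ∩ TC.sem M₃ C := by
  induction hC with
  | atom a => rfl
  | nextF _ ih => ext n; simp only [TC.sem, ih]; rfl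
  | nextP _ ih => ext n; simp only [TC.sem, ih]; rfl

/-- Binary clauses are preserved by pointwise majority. -/
theorem Clause.holds.majority {cl : Clause} (hcl : cl.AllBasicNext) (hk : cl.Krom)
    {M₁ M₂ M₃ : Itp} (h₁ : cl.holds M₁) (h₂ : cl.holds M₂) (h₃ : cl.holds M₃) :
    cl.holds (Itp.majority M₁ M₂ M₃) := by
  intro n hn
  have hp : ∀ C ∈ cl.prem, (n ∈ TC.sem M₁ C ∧ n ∈ TC.sem M₂ C) ∨
      (n ∈ TC.sem M₁ C ∧ n ∈ TC.sem M₃ C) ∨ (n ∈ TC.sem M₂ C ∧ n ∈ TC.sem M₃ C) := by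
    intro C hC
    have := hn C hC
    rw [(hcl.1 C hC).sem_majority] at this
    simpa [or_assoc] using this
  suffices ∃ C ∈ cl.concl, (n ∈ TC.sem M₁ C ∧ n ∈ TC.sem M₂ C) ∨
      (n ∈ TC.sem M₁ C ∧ n ∈ TC.sem M₃ C) ∨ (n ∈ TC.sem M₂ C ∧ n ∈ TC.sem M₃ C) by
    obtain ⟨C, hC, h⟩ := this
    refine ⟨C, hC, ?_⟩
    rw [(hcl.2 C hC).sem_majority]
    simpa [or_assoc] using h
  replace h₁ := h₁ n
  replace h₂ := h₂ n
  replace h₃ := h₃ n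
  clear hn hcl
  obtain ⟨p, c⟩ := cl
  simp only [Clause.Krom] at *
  match p, c with
  | [], [] => simp at h₁
  | [], [C] => simp_all
  | [], [C, D] => simp at *; tauto
  | [B], [] => simp at *; tauto
  | [B], [C] => simp at *; tauto
  | [B, C], [] => simp at *; tauto
  | _ :: _ :: _ :: _, _ => simp at hk; omega
  | _, _ :: _ :: _ :: _ => simp at hk; omega
  | _ :: _ :: _, _ :: _ => simp at hk; omega
  | _ :: _, _ :: _ :: _ => simp at hk; omega

/-- Helly property: finitely many positive facts that are jointly satisfiable, and each of which is
compatible with a given negative fact, are jointly compatible with it. -/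
theorem Ontology.KromNext.exists_model_of_pairwise {O : Ontology} (hO : O.KromNext)
    {N : Itp} (hN : ∀ cl ∈ O, cl.holds N) {a : ℕ} {ℓ : ℤ} {S : Finset (ℕ × ℤ)}
    (hS : S.Nonempty) (hNS : ∀ p ∈ S, p.2 ∈ N p.1)
    (hpair : ∀ p ∈ S, ∃ M : Itp, (∀ cl ∈ O, cl.holds M) ∧ p.2 ∈ M p.1 ∧ ℓ ∉ M a) :
    ∃ M : Itp, (∀ cl ∈ O, cl.holds M) ∧ (∀ p ∈ S, p.2 ∈ M p.1) ∧ ℓ ∉ M a := by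
  induction hS using Finset.Nonempty.cons_induction with
  | singleton p => simpa using hpair
  | cons p S _ _ ih =>
    simp only [Finset.mem_cons, forall_eq_or_imp] at hNS hpair
    obtain ⟨M, hM, hMS, hMa⟩ := ih hNS.2 hpair.2
    obtain ⟨M', hM', hMp, hMa'⟩ := hpair.1
    refine ⟨Itp.majority M M' N, fun cl hcl =>
      (hM cl hcl).majority (hO cl hcl).1 (hO cl hcl).2 (hM' cl hcl) (hN cl hcl), ?_, ?_⟩
    · simp only [Finset.mem_cons, forall_eq_or_imp]
      exact ⟨Or.inr ⟨hMp, hNS.1⟩, fun q hq => Or.inl (Or.inr ⟨hMS q hq, hNS.2 q hq⟩)⟩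
    · simp [Itp.majority, hMa, hMa']

/-- certain answers of LTL_krom^○ OMAQs via the reachability
relation ⇝. -/
theorem kromNext_certAnsZ_iff_leadsTo (O : Ontology) (hO : O.KromNext) (hflat : O.Flat)
    (hcons : O.Consistent) (a : ℕ) (ha : O.occurs a)
    (A : DataInstance) (hA : ConsistentWith O A) (ℓ : ℤ) :
    ℓ ∈ certAnsZ O (.atom a) A ↔
      ∃ p ∈ A.atoms, leadsTo O (p.1, true) p.2 (a, true) ℓ := by
  constructor
  · intro h
    by_contra! hno
    obtain ⟨N, hN, hNA⟩ := hA
    obtain ⟨p₀, hp₀, -⟩ := A.has_zero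
    obtain ⟨M, hM, hMA, hMa⟩ := hO.exists_model_of_pairwise hN ⟨p₀, hp₀⟩ hNA (a := a) (ℓ := ℓ) (by
      intro p hp
      have hp' := hno p hp
      rw [leadsTo_pos_iff] at hp'
      push Not at hp'
      obtain ⟨M, hM, m, hm, hmℓ⟩ := hp'
      rw [add_comm] at hm hmℓ
      exact ⟨M.translate m, fun cl hcl => (hM cl hcl).translate (hO cl hcl).1 m, hm, hmℓ⟩)
    exact hMa (h M ⟨hM, hMA⟩)
  · rintro ⟨p, hp, hlead⟩ M ⟨hM, hMA⟩
    rw [leadsTo_pos_iff] at hlead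
    simpa [TC.sem] using hlead M hM 0 (by simpa using hMA p hp)

end LTLOMQ
end
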